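/- Let α, β, γ, δ, c, ε be real constants with γ ≠ 0. Suppose U, W : ℝ × ℝ → ℝ are four times continuously differentiable and satisfy the potential coupled Boussinesq system at every point. Then the local momentum conservation law holds at every point: ∂_t( U_t U_x + (δ/γ) W_t W_x + ε U_tx U_xx + (εβδ/γ) W_tx W_xx ) − ∂_x( ε U_x U_ttx + (εβδ/γ) W_x W_ttx + (1/2)[ U_t² + (δ/γ) W_t² + U_x² + (δc²/γ) W_x² + (2ε/3)( U_x³ + (αδ/γ) W_x³ ) + ε U_tx² + (εβδ/γ) W_tx² − εδ (U − W)² ] ) = 0. -/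

import Mathlib

/-- Partial derivative in the first variable (space `x`). -/
noncomputable def pd1 (f : ℝ → ℝ → ℝ) (x y : ℝ) : ℝ := deriv (fun x' => f x' y) x

/-- Partial derivative in the second variable (time `t`). -/
noncomputable def pd2 (f : ℝ → ℝ → ℝ) (x y : ℝ) : ℝ := deriv (fun y' => f x y') y

/-- The potential coupled Boussinesq system:
`U_tt − U_xx = ε[ U_x U_xx + U_ttxx − δ(U − W) ]`,
`W_tt − c² W_xx = ε[ α W_x W_xx + β W_ttxx + γ(U − W) ]`. -/
def potCB (α β γ δ c ε : ℝ) (U W : ℝ → ℝ → ℝ) : Prop :=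
  ∀ x t : ℝ,
    pd2 (pd2 U) x t - pd1 (pd1 U) x t
      = ε * (pd1 U x t * pd1 (pd1 U) x t + pd1 (pd1 (pd2 (pd2 U))) x t
          - δ * (U x t - W x t)) ∧
    pd2 (pd2 W) x t - c ^ 2 * pd1 (pd1 W) x t
      = ε * (α * pd1 W x t * pd1 (pd1 W) x t + β * pd1 (pd1 (pd2 (pd2 W))) x t
          + γ * (U x t - W x t))

open Function

theorem pd1_eq_fderiv {f : ℝ → ℝ → ℝ} (hf : Differentiable ℝ (uncurry f)) (x y : ℝ) :
    pd1 f x y = fderiv ℝ (uncurry f) (x, y) (1, 0) :=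
  ((hf (x, y)).hasFDerivAt.comp_hasDerivAt (f := fun x' : ℝ => (x', y)) x
    ((hasDerivAt_id x).prodMk (hasDerivAt_const x y))).deriv

theorem pd2_eq_fderiv {f : ℝ → ℝ → ℝ} (hf : Differentiable ℝ (uncurry f)) (x y : ℝ) :
    pd2 f x y = fderiv ℝ (uncurry f) (x, y) (0, 1) :=
  ((hf (x, y)).hasFDerivAt.comp_hasDerivAt (f := fun y' : ℝ => (x, y')) y
    ((hasDerivAt_const y x).prodMk (hasDerivAt_id y))).deriv

theorem hasDerivAt_pd1 {f : ℝ → ℝ → ℝ} (hf : Differentiable ℝ (uncurry f)) (x y : ℝ) :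
    HasDerivAt (fun x' => f x' y) (pd1 f x y) x :=
  ((hf (x, y)).comp (f := fun x' : ℝ => (x', y)) x (by fun_prop)).hasDerivAt

theorem hasDerivAt_pd2 {f : ℝ → ℝ → ℝ} (hf : Differentiable ℝ (uncurry f)) (x y : ℝ) :
    HasDerivAt (fun y' => f x y') (pd2 f x y) y :=
  ((hf (x, y)).comp (f := fun y' : ℝ => (x, y')) y (by fun_prop)).hasDerivAt

theorem uncurry_pd1 {f : ℝ → ℝ → ℝ} (hf : Differentiable ℝ (uncurry f)) :
    uncurry (pd1 f) = fun p => fderiv ℝ (uncurry f) p (1, 0) :=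
  funext fun p => pd1_eq_fderiv hf p.1 p.2

theorem uncurry_pd2 {f : ℝ → ℝ → ℝ} (hf : Differentiable ℝ (uncurry f)) :
    uncurry (pd2 f) = fun p => fderiv ℝ (uncurry f) p (0, 1) :=
  funext fun p => pd2_eq_fderiv hf p.1 p.2

theorem ContDiff.pd1 {f : ℝ → ℝ → ℝ} {m n : WithTop ℕ∞} (hf : ContDiff ℝ n (uncurry f))
    (hmn : m + 1 ≤ n) : ContDiff ℝ m (uncurry (pd1 f)) := by
  rw [uncurry_pd1 ((hf.of_le (le_add_self.trans hmn)).differentiable one_ne_zero)]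
  exact (hf.fderiv_right hmn).clm_apply contDiff_const

theorem ContDiff.pd2 {f : ℝ → ℝ → ℝ} {m n : WithTop ℕ∞} (hf : ContDiff ℝ n (uncurry f))
    (hmn : m + 1 ≤ n) : ContDiff ℝ m (uncurry (pd2 f)) := by
  rw [uncurry_pd2 ((hf.of_le (le_add_self.trans hmn)).differentiable one_ne_zero)]
  exact (hf.fderiv_right hmn).clm_apply contDiff_const

/-- Mixed partial derivatives of a `C²` function commute. -/
theorem pd2_pd1_comm {f : ℝ → ℝ → ℝ} (hf : ContDiff ℝ 2 (uncurry f)) :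
    pd2 (pd1 f) = pd1 (pd2 f) := by
  have hd : Differentiable ℝ (uncurry f) := hf.differentiable two_ne_zero
  have h12 : (1 : WithTop ℕ∞) + 1 ≤ 2 := by norm_num
  have hd' : Differentiable ℝ (fderiv ℝ (uncurry f)) :=
    (hf.fderiv_right h12).differentiable one_ne_zero
  funext x y
  rw [pd2_eq_fderiv ((hf.pd1 h12).differentiable one_ne_zero),
    pd1_eq_fderiv ((hf.pd2 h12).differentiable one_ne_zero), uncurry_pd1 hd, uncurry_pd2 hd,
    fderiv_clm_apply (hd' _) (differentiableAt_const _),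
    fderiv_clm_apply (hd' _) (differentiableAt_const _)]
  have hsymm : IsSymmSndFDerivAt ℝ (uncurry f) (x, y) :=
    hf.contDiffAt.isSymmSndFDerivAt (by simp)
  simpa using hsymm.eq (0, 1) (1, 0)

/-- Local momentum conservation law for C⁴ solutions of the potential coupled
Boussinesq system. -/
theorem stmt9 (α β γ δ c ε : ℝ) (hγ : γ ≠ 0) (U W : ℝ → ℝ → ℝ)
    (hU : ContDiff ℝ 4 (Function.uncurry U)) (hW : ContDiff ℝ 4 (Function.uncurry W))
    (hsys : potCB α β γ δ c ε U W) :
    ∀ x t : ℝ,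
      pd2 (fun x t => pd2 U x t * pd1 U x t + (δ / γ) * pd2 W x t * pd1 W x t
          + ε * pd1 (pd2 U) x t * pd1 (pd1 U) x t
          + (ε * β * δ / γ) * pd1 (pd2 W) x t * pd1 (pd1 W) x t) x t
        - pd1 (fun x t => ε * pd1 U x t * pd1 (pd2 (pd2 U)) x t
            + (ε * β * δ / γ) * pd1 W x t * pd1 (pd2 (pd2 W)) x t
            + (1 / 2) * ((pd2 U x t) ^ 2 + (δ / γ) * (pd2 W x t) ^ 2
              + (pd1 U x t) ^ 2 + (δ * c ^ 2 / γ) * (pd1 W x t) ^ 2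
              + (2 * ε / 3) * ((pd1 U x t) ^ 3 + (α * δ / γ) * (pd1 W x t) ^ 3)
              + ε * (pd1 (pd2 U) x t) ^ 2 + (ε * β * δ / γ) * (pd1 (pd2 W) x t) ^ 2
              - ε * δ * (U x t - W x t) ^ 2)) x t
      = 0 := by
  intro x t
  have h12 : (1 : WithTop ℕ∞) + 1 ≤ 2 := by norm_num
  have h23 : (2 : WithTop ℕ∞) + 1 ≤ 3 := by norm_num
  have h34 : (3 : WithTop ℕ∞) + 1 ≤ 4 := by norm_num
  have hderiv : ∀ V : ℝ → ℝ → ℝ, ContDiff ℝ 4 (uncurry V) →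
      HasDerivAt (fun s => V s t) (pd1 V x t) x ∧
      HasDerivAt (fun s => pd1 V s t) (pd1 (pd1 V) x t) x ∧
      HasDerivAt (fun s => pd2 V s t) (pd1 (pd2 V) x t) x ∧
      HasDerivAt (fun s => pd1 (pd2 V) s t) (pd1 (pd1 (pd2 V)) x t) x ∧
      HasDerivAt (fun s => pd1 (pd2 (pd2 V)) s t) (pd1 (pd1 (pd2 (pd2 V))) x t) x ∧
      HasDerivAt (fun s => pd1 V x s) (pd1 (pd2 V) x t) t ∧
      HasDerivAt (fun s => pd2 V x s) (pd2 (pd2 V) x t) t ∧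
      HasDerivAt (fun s => pd1 (pd2 V) x s) (pd1 (pd2 (pd2 V)) x t) t ∧
      HasDerivAt (fun s => pd1 (pd1 V) x s) (pd1 (pd1 (pd2 V)) x t) t := by
    intro V hV
    have hV1 := hV.pd1 h34
    have hV2 := hV.pd2 h34
    have hV11 := hV1.pd1 h23
    have hV12 := hV2.pd1 h23
    have hV22 := hV2.pd2 h23
    have hV122 := hV22.pd1 h12
    have d := hV.differentiable four_ne_zero
    have d1 := hV1.differentiable three_ne_zero
    have d2 := hV2.differentiable three_ne_zero
    have d11 := hV11.differentiable two_ne_zero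
    have d12 := hV12.differentiable two_ne_zero
    have d122 := hV122.differentiable one_ne_zero
    have e : pd2 (pd1 V) = pd1 (pd2 V) :=
      pd2_pd1_comm (hV.of_le (by norm_num))
    have e2 : pd2 (pd1 (pd2 V)) = pd1 (pd2 (pd2 V)) :=
      pd2_pd1_comm (hV2.of_le (by norm_num))
    have e1 : pd2 (pd1 (pd1 V)) = pd1 (pd1 (pd2 V)) := by
      rw [pd2_pd1_comm (hV1.of_le (by norm_num)), e]
    exact ⟨hasDerivAt_pd1 d x t, hasDerivAt_pd1 d1 x t, hasDerivAt_pd1 d2 x t,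
      hasDerivAt_pd1 d12 x t, hasDerivAt_pd1 d122 x t, e ▸ hasDerivAt_pd2 d1 x t,
      hasDerivAt_pd2 d2 x t, e2 ▸ hasDerivAt_pd2 d12 x t, e1 ▸ hasDerivAt_pd2 d11 x t⟩
  obtain ⟨u, ux, utx, utxx, uttxx, uxt, utt, uttx, uxxt⟩ := hderiv U hU
  obtain ⟨w, wx, wtx, wtxx, wttxx, wxt, wtt, wttx, wxxt⟩ := hderiv W hW
  have hdensity := (((utt.mul uxt).add ((wtt.const_mul (δ / γ)).mul wxt)).add
    ((uttx.const_mul ε).mul uxxt)).add ((wttx.const_mul (ε * β * δ / γ)).mul wxxt)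
  have hquad := ((((((utx.pow 2).add ((wtx.pow 2).const_mul (δ / γ))).add (ux.pow 2)).add
    ((wx.pow 2).const_mul (δ * c ^ 2 / γ))).add
    (((ux.pow 3).add ((wx.pow 3).const_mul (α * δ / γ))).const_mul (2 * ε / 3))).add
    ((utxx.pow 2).const_mul ε)).add ((wtxx.pow 2).const_mul (ε * β * δ / γ)) |>.sub
    (((u.sub w).pow 2).const_mul (ε * δ))
  have hflux := (((ux.const_mul ε).mul uttxx).add
    ((wx.const_mul (ε * β * δ / γ)).mul wttxx)).add (hquad.const_mul (1 / 2))
  refine (congrArg₂ (· - ·) hdensity.deriv hflux.deriv).trans ?_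
  obtain ⟨hUeq, hWeq⟩ := hsys x t
  rw [Pi.sub_apply]
  field_simp
  linear_combination 6 * γ * pd1 U x t * hUeq + 6 * δ * pd1 W x t * hWeq
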